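/- arXiv:2409.16560 — 2 statements merged into one kernel-verified Lean document; each statement's English description precedes it below -/
import Mathlib

section
/- Let V be a finite nonempty type and let p, q be probability mass functions on V with α(p,q) = Σ_{x ∈ V} min(p x, q x) < 1, and let res(p,q) x = (p x − min(p x, q x)) / (1 − α(p,q)). Then for every x ∈ V, q x · min(1, p x / q x) + (1 − α(p,q)) · res(p,q) x = p x (with the convention that p x / q x = 0 when q x = 0, as in Lean's real division). Consequently, the output of one step of speculative sampling — draw x from q, accept it with probability min(1, p x / q x), and on rejection draw from res(p,q) — is distributed exactly according to p. -/
/-- For probability mass functions `p, q` on a finite nonempty type `V`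
with acceptance mass `α(p,q) = Σ_x min (p x) (q x) < 1` and residual
`res(p,q) x = (p x − min (p x) (q x)) / (1 − α(p,q))`, for every `x` we have
`q x · min(1, p x / q x) + (1 − α(p,q)) · res(p,q) x = p x`
(with `p x / q x = 0` when `q x = 0`, as in Lean's real division).  Hence the output of
one step of speculative sampling is distributed exactly according to `p`. -/
theorem speculative_step_correct
    {V : Type*} [Fintype V] [Nonempty V] (p q : V → ℝ)
    (hp0 : ∀ x, 0 ≤ p x) (hp1 : ∑ x, p x = 1)
    (hq0 : ∀ x, 0 ≤ q x) (hq1 : ∑ x, q x = 1)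
    (hα : (∑ x, min (p x) (q x)) < 1) :
    ∀ x, q x * min 1 (p x / q x) +
        (1 - ∑ y, min (p y) (q y)) *
          ((p x - min (p x) (q x)) / (1 - ∑ y, min (p y) (q y))) = p x := by
  intro x
  have hne : (1 - ∑ y, min (p y) (q y)) ≠ 0 := by linarith
  rw [mul_div_cancel₀ _ hne]
  have key : q x * min 1 (p x / q x) = min (p x) (q x) := by
    rcases (hq0 x).eq_or_lt with h | h
    · rw [← h, zero_mul, min_eq_right (hp0 x)]
    · rw [mul_min_of_nonneg _ _ h.le, mul_one, mul_div_cancel₀ _ h.ne', min_comm]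
  rw [key]
  ring
end

section
/- Let V be a finite nonempty type, let p, q be probability mass functions on V, let m ≥ 1, and define the residual chain p_1 = p, α_k = Σ_{x ∈ V} min(p_k x, q x), p_{k+1} x = (p_k x − min(p_k x, q x)) / (1 − α_k), with α_k < 1 for all 1 ≤ k ≤ m. Then the output distribution of sequential speculative verification with m independent drafts from q, namely D x = Σ_{i=1}^{m} (Π_{j=1}^{i−1} (1 − α_j)) · min(q x, p_i x) + (Π_{j=1}^{m} (1 − α_j)) · p_{m+1} x, satisfies D x = p x for every x ∈ V. That is, the first output beam produced by the draft-and-verification scheme is distributed exactly according to the target distribution p (this is the marginal-distribution content of the paper's Theorem 1, Correctness of Draft and Verification Scheme). -/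
/-- Given probability mass functions `p, q` on a finite nonempty type `V`,
`m ≥ 1`, and the residual chain `p₁ = p`, `α_k = Σ_x min (p_k x) (q x)`,
`p_{k+1} x = (p_k x − min (p_k x) (q x)) / (1 − α_k)` with `α_k < 1` for `1 ≤ k ≤ m`,
the output distribution of sequential speculative verification with `m` i.i.d. drafts
from `q`, namely
`D x = Σ_{i=1}^m (Π_{j=1}^{i−1} (1 − α_j)) · min (q x) (p_i x)
      + (Π_{j=1}^m (1 − α_j)) · p_{m+1} x`,
satisfies `D x = p x` for every `x`. -/
theorem speculative_verification_marginal_correct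
    {V : Type*} [Fintype V] [Nonempty V] (p q : V → ℝ)
    (hp0 : ∀ x, 0 ≤ p x) (hp1 : ∑ x, p x = 1)
    (hq0 : ∀ x, 0 ≤ q x) (hq1 : ∑ x, q x = 1)
    (m : ℕ) (hm : 1 ≤ m)
    (P : ℕ → V → ℝ) (α : ℕ → ℝ)
    (hP1 : P 1 = p)
    (hα : ∀ k, 1 ≤ k → k ≤ m → α k = ∑ x, min (P k x) (q x))
    (hrec : ∀ k, 1 ≤ k → k ≤ m → ∀ x,
      P (k + 1) x = (P k x - min (P k x) (q x)) / (1 - α k))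
    (hαlt : ∀ k, 1 ≤ k → k ≤ m → α k < 1) :
    ∀ x, (∑ i ∈ Finset.Icc 1 m,
            (∏ j ∈ Finset.Icc 1 (i - 1), (1 - α j)) * min (q x) (P i x)) +
          (∏ j ∈ Finset.Icc 1 m, (1 - α j)) * P (m + 1) x = p x := by
  intro x
  have key : ∀ n, n ≤ m → (∑ i ∈ Finset.Icc 1 n,
            (∏ j ∈ Finset.Icc 1 (i - 1), (1 - α j)) * min (q x) (P i x)) +
          (∏ j ∈ Finset.Icc 1 n, (1 - α j)) * P (n + 1) x = p x := by
    intro n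
    induction n with
    | zero => intro _; simp [hP1]
    | succ n ih =>
      intro hn
      have h := ih (by omega)
      have hne : 1 - α (n + 1) ≠ 0 := by
        have := hαlt (n + 1) (by omega) hn
        linarith
      have hr : (1 - α (n + 1)) * P (n + 1 + 1) x
          = P (n + 1) x - min (q x) (P (n + 1) x) := by
        rw [hrec (n + 1) (by omega) hn x, min_comm (q x), mul_div_cancel₀ _ hne]
      rw [Finset.sum_Icc_succ_top (by omega), Finset.prod_Icc_succ_top (by omega),
        mul_assoc, hr, Nat.add_sub_cancel, ← h]
      ring
  exact key m le_rfl
end
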